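/- arXiv:2605.22854 — 3 statements merged into one kernel-verified Lean document; each statement's English description precedes it below -/
import Mathlib

section
/- Let ς, τ, δ, z ∈ ℂ with Re(ς) > 0, Re(τ) > 0. Then the derivative of the Prabhakar function satisfies (d/dz) E^δ_{ς,τ}(z) = δ · E^{δ+1}_{ς,τ+ς}(z), and more generally the n-th derivative satisfies (d/dz)^n E^δ_{ς,τ}(z) = (δ)_n · E^{δ+n}_{ς,τ+nς}(z). -/
noncomputable def prabTerm (ς τ δ z : ℂ) (k : ℕ) : ℂ :=
  (∏ i ∈ Finset.range k, (δ + i)) * z ^ k /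
    ((k.factorial : ℂ) * Complex.Gamma (ς * k + τ))

/-- The complex Prabhakar (three-parameter Mittag-Leffler) function. -/
noncomputable def cPrab (ς τ δ z : ℂ) : ℂ := ∑' k : ℕ, prabTerm ς τ δ z k

open Filter Topology Set MeasureTheory

/-- The Beta integral tends to zero as the real part of its first argument tends to infinity. -/
theorem tendsto_betaIntegral_zero {ι : Type*} {l : Filter ι} [l.IsCountablyGenerated]
    {s : ι → ℂ} {v : ℂ} (hv : 0 < v.re) (hs : Tendsto (fun i => (s i).re) l atTop) :
    Tendsto (fun i => Complex.betaIntegral (s i) v) l (𝓝 0) := by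
  have key : Tendsto (fun i => ∫ x in (0 : ℝ)..1, (x : ℂ) ^ (s i - 1) * (1 - (x : ℂ)) ^ (v - 1)) l
      (𝓝 (∫ _x in (0 : ℝ)..1, (0 : ℂ))) := by
    have h_ne : ∀ᵐ x : ℝ, x ≠ 1 := by simp [ae_iff]
    refine intervalIntegral.tendsto_integral_filter_of_dominated_convergence
      (fun x => ‖(x : ℂ) ^ ((1 : ℂ) - 1) * (1 - (x : ℂ)) ^ (v - 1)‖) ?_ ?_ ?_ ?_
    · filter_upwards [hs.eventually_ge_atTop 1] with i hi
      have := (Complex.betaIntegral_convergent (by linarith : 0 < (s i).re) hv).1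
      simpa [uIoc_of_le] using this.aestronglyMeasurable
    · filter_upwards [hs.eventually_ge_atTop 1] with i hi
      refine ae_of_all _ fun x hx => ?_
      rw [uIoc_of_le zero_le_one] at hx
      rw [norm_mul, norm_mul]
      gcongr
      rw [Complex.norm_cpow_eq_rpow_re_of_pos hx.1, Complex.norm_cpow_eq_rpow_re_of_pos hx.1]
      exact Real.rpow_le_rpow_of_exponent_ge hx.1 hx.2 (by simpa using hi)
    · exact (Complex.betaIntegral_convergent (by simp : 0 < (1 : ℂ).re) hv).norm
    · filter_upwards [h_ne] with x hx1 hx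
      rw [uIoc_of_le zero_le_one] at hx
      have hlt : x < 1 := lt_of_le_of_ne hx.2 hx1
      have h0 : Tendsto (fun i => (x : ℂ) ^ (s i - 1)) l (𝓝 0) := by
        rw [tendsto_zero_iff_norm_tendsto_zero]
        simp_rw [Complex.norm_cpow_eq_rpow_re_of_pos hx.1]
        refine (tendsto_rpow_atTop_of_base_lt_one x (by linarith [hx.1]) hlt).comp ?_
        simpa [sub_eq_add_neg] using tendsto_atTop_add_const_right l (-1 : ℝ) hs
      simpa using h0.mul_const ((1 - (x : ℂ)) ^ (v - 1))
  simpa [Complex.betaIntegral] using key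

theorem tendsto_Gamma_div_Gamma_add_zero {ι : Type*} {l : Filter ι} [l.IsCountablyGenerated]
    {s : ι → ℂ} {v : ℂ} (hv : 0 < v.re) (hs : Tendsto (fun i => (s i).re) l atTop) :
    Tendsto (fun i => Complex.Gamma (s i) / Complex.Gamma (s i + v)) l (𝓝 0) := by
  have h := (tendsto_betaIntegral_zero hv hs).div_const (Complex.Gamma v)
  rw [zero_div] at h
  refine h.congr' ?_
  filter_upwards [hs.eventually_gt_atTop 0] with i hi
  rw [Complex.betaIntegral_eq_Gamma_mul_div _ _ hi hv]
  have := Complex.Gamma_ne_zero_of_re_pos hv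
  field_simp

theorem re_mul_natCast_add_pos {ς τ : ℂ} (hς : 0 < ς.re) (hτ : 0 < τ.re) (k : ℕ) :
    0 < (ς * k + τ).re := by
  simp only [Complex.add_re, Complex.mul_re, Complex.natCast_re, Complex.natCast_im, mul_zero,
    sub_zero]
  positivity

theorem prabTerm_succ {ς τ : ℂ} (hς : 0 < ς.re) (hτ : 0 < τ.re) (δ z : ℂ) (k : ℕ) :
    prabTerm ς τ δ z (k + 1) =
      z * ((δ + k) / ((k : ℂ) + 1)) *
        (Complex.Gamma (ς * k + τ) / Complex.Gamma (ς * k + τ + ς)) * prabTerm ς τ δ z k := by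
  have hG := Complex.Gamma_ne_zero_of_re_pos (re_mul_natCast_add_pos hς hτ k)
  have hk : (k : ℂ) + 1 ≠ 0 := Nat.cast_add_one_ne_zero k
  have hf : (k.factorial : ℂ) ≠ 0 := by exact_mod_cast k.factorial_ne_zero
  have he : ς * ((k + 1 : ℕ) : ℂ) + τ = ς * k + τ + ς := by push_cast; ring
  simp only [prabTerm, Finset.prod_range_succ, he, Nat.factorial_succ, pow_succ]
  generalize Complex.Gamma (ς * k + τ) = G at hG ⊢
  push_cast
  field_simp

theorem summable_prabTerm {ς τ : ℂ} (hς : 0 < ς.re) (hτ : 0 < τ.re) (δ z : ℂ) :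
    Summable (prabTerm ς τ δ z) := by
  have hre : Tendsto (fun k : ℕ => (ς * k + τ).re) atTop atTop := by
    simpa using tendsto_atTop_add_const_right atTop τ.re
      (tendsto_natCast_atTop_atTop.const_mul_atTop hς)
  have hfrac : Tendsto (fun k : ℕ => (δ + k) / ((k : ℂ) + 1)) atTop (𝓝 1) := by
    simpa [add_comm] using
      tendsto_add_mul_div_add_mul_atTop_nhds δ 1 (1 : ℂ) one_ne_zero
  have hratio := ((hfrac.const_mul z).mul (tendsto_Gamma_div_Gamma_add_zero hς hre)).norm
  rw [mul_zero, norm_zero] at hratio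
  refine summable_of_ratio_norm_eventually_le (r := 1 / 2) (by norm_num) ?_
  filter_upwards [hratio.eventually_le_const (by norm_num : (0 : ℝ) < 1 / 2)] with k hk
  rw [prabTerm_succ hς hτ, norm_mul]
  gcongr

theorem hasDerivAt_prabTerm_succ (ς τ δ z : ℂ) (k : ℕ) :
    HasDerivAt (fun w => prabTerm ς τ δ w (k + 1)) (δ * prabTerm ς (τ + ς) (δ + 1) z k) z := by
  have h := ((hasDerivAt_pow (k + 1) z).const_mul
    (∏ i ∈ Finset.range (k + 1), (δ + i))).div_const
      (((k + 1).factorial : ℂ) * Complex.Gamma (ς * (k + 1 : ℕ) + τ))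
  refine h.congr_deriv ?_
  have hk : (k : ℂ) + 1 ≠ 0 := Nat.cast_add_one_ne_zero k
  have he : ς * ((k + 1 : ℕ) : ℂ) + τ = ς * k + (τ + ς) := by push_cast; ring
  have hp : ∏ i ∈ Finset.range (k + 1), (δ + i) =
      δ * ∏ i ∈ Finset.range k, (δ + 1 + i) := by
    rw [Finset.prod_range_succ', mul_comm]
    simp [add_assoc, add_comm (1 : ℂ)]
  rw [he, hp, prabTerm, Nat.factorial_succ, Nat.add_sub_cancel]
  generalize Complex.Gamma (ς * k + (τ + ς)) = G
  push_cast
  field_simp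

theorem norm_prabTerm_le_of_norm_le (ς τ δ : ℂ) {z w : ℂ} (h : ‖z‖ ≤ ‖w‖) (k : ℕ) :
    ‖prabTerm ς τ δ z k‖ ≤ ‖prabTerm ς τ δ w k‖ := by
  simp only [prabTerm, norm_div, norm_mul, norm_pow]
  gcongr

theorem hasDerivAt_cPrab {ς τ : ℂ} (hς : 0 < ς.re) (hτ : 0 < τ.re) (δ z : ℂ) :
    HasDerivAt (cPrab ς τ δ) (δ * cPrab ς (τ + ς) (δ + 1) z) z := by
  have hτ' : 0 < (τ + ς).re := by rw [Complex.add_re]; positivity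
  have hz : z ∈ Metric.ball (0 : ℂ) (‖z‖ + 1) := by simp
  have hsum := ((summable_prabTerm hς hτ' (δ + 1) ((‖z‖ + 1 : ℝ) : ℂ)).mul_left δ).norm
  have htail := hasDerivAt_tsum_of_isPreconnected hsum Metric.isOpen_ball
    (convex_ball (0 : ℂ) (‖z‖ + 1)).isPreconnected
    (fun k y _ => hasDerivAt_prabTerm_succ ς τ δ y k)
    (fun k y hy => by
      rw [norm_mul, norm_mul]
      gcongr
      refine norm_prabTerm_le_of_norm_le _ _ _ ?_ k
      rw [Complex.norm_real, Real.norm_of_nonneg (by positivity)]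
      exact (mem_ball_zero_iff.mp hy).le)
    hz ((summable_nat_add_iff 1).mpr (summable_prabTerm hς hτ δ z)) hz
  rw [tsum_mul_left] at htail
  have hfun : cPrab ς τ δ = fun w =>
      1 / Complex.Gamma τ + ∑' k : ℕ, prabTerm ς τ δ w (k + 1) := by
    funext w
    rw [cPrab, (summable_prabTerm hς hτ δ w).tsum_eq_zero_add]
    simp [prabTerm]
  rw [hfun]
  exact htail.const_add _

theorem prabhakar_deriv (ς τ δ : ℂ) (hς : 0 < ς.re) (hτ : 0 < τ.re) :
    (∀ z : ℂ, deriv (fun w => cPrab ς τ δ w) z = δ * cPrab ς (τ + ς) (δ + 1) z) ∧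
    ∀ (n : ℕ) (z : ℂ),
      iteratedDeriv n (fun w => cPrab ς τ δ w) z =
        (∏ i ∈ Finset.range n, (δ + i)) * cPrab ς (τ + n * ς) (δ + n) z := by
  refine ⟨fun z => (hasDerivAt_cPrab hς hτ δ z).deriv, fun n => ?_⟩
  induction n with
  | zero => simp
  | succ n ih =>
    intro z
    have hn : 0 < (τ + n * ς).re := by
      simpa [add_comm, mul_comm] using re_mul_natCast_add_pos hς hτ n
    have hτn : τ + ((n + 1 : ℕ) : ℂ) * ς = τ + n * ς + ς := by push_cast; ring
    have hδn : δ + ((n + 1 : ℕ) : ℂ) = δ + n + 1 := by push_cast; ring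
    rw [iteratedDeriv_succ, funext ih,
      ((hasDerivAt_cPrab hς hn (δ + n) z).const_mul _).deriv, Finset.prod_range_succ, hτn, hδn,
      mul_assoc]
end

section
/- Let ς, τ, δ, ω ∈ ℂ with Re(ς) > 0 and Re(τ) > 1. Then for z > 0, d/dz [ z^{τ-1} E^δ_{ς,τ}(ω z^ς) ] = z^{τ-2} E^δ_{ς,τ-1}(ω z^ς). -/
open Filter in
/-- On the half-plane `2 ≤ re s`, the Gamma function is comparable to its restriction to the real
line, up to a Gaussian factor in the imaginary part. -/
lemma Complex.Gamma_re_mul_exp_le_norm_Gamma {s : ℂ} (hs : 2 ≤ s.re) :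
    Real.Gamma s.re * Real.exp (-(s.im ^ 2 / s.re)) ≤ ‖Complex.Gamma s‖ := by
  set x := s.re with hx
  set y := s.im with hy
  have hfac (j : ℕ) :
      ‖s + j‖ ≤ (x + j) * Real.exp (y ^ 2 / 2 * (1 / (x + j) ^ 2)) := by
    have hpos : 0 < x + j := by positivity
    refine le_of_sq_le_sq ?_ (by positivity)
    rw [mul_pow, ← Real.exp_nat_mul, Complex.sq_norm, Complex.normSq_apply]
    simp only [Complex.add_re, Complex.add_im, Complex.natCast_re, Complex.natCast_im, ← hx, ← hy]
    have h := Real.add_one_le_exp (((2 : ℕ) : ℝ) * (y ^ 2 / 2 * (1 / (x + j) ^ 2)))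
    refine le_trans (le_of_eq ?_) (mul_le_mul_of_nonneg_left h (by positivity))
    push_cast
    field_simp
    ring
  have hsum (n : ℕ) : ∑ j ∈ Finset.range n, 1 / (x + j) ^ 2 ≤ 2 / x := by
    have htel : ∑ j ∈ Finset.range n, 1 / (x + j) ^ 2 ≤ 1 / (x - 1) - 1 / (x + n - 1) := by
      induction n with
      | zero => simp
      | succ n ih =>
        rw [Finset.sum_range_succ]
        have h1 : 0 < x + n - 1 := by
          have : (0 : ℝ) ≤ n := n.cast_nonneg
          linarith
        have h2 : 0 < x + n := by linarith
        have h3 : 1 / (x + n) ^ 2 ≤ 1 / (x + n - 1) - 1 / (x + n) := by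
          rw [div_sub_div _ _ h1.ne' h2.ne', div_le_div_iff₀ (by positivity) (by positivity)]
          nlinarith
        have h4 : x + ((n + 1 : ℕ) : ℝ) - 1 = x + n := by push_cast; ring
        rw [h4]
        linarith
    have h1 : 0 ≤ 1 / (x + n - 1) := by
      have : (0 : ℝ) ≤ n := n.cast_nonneg
      exact div_nonneg zero_le_one (by linarith)
    have h2 : 1 / (x - 1) ≤ 2 / x := by
      rw [div_le_div_iff₀ (by linarith) (by linarith)]
      linarith
    linarith
  have hprod (n : ℕ) : ∏ j ∈ Finset.range n, ‖s + j‖ ≤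
      (∏ j ∈ Finset.range n, (x + j)) * Real.exp (y ^ 2 / x) := by
    calc ∏ j ∈ Finset.range n, ‖s + j‖
        ≤ ∏ j ∈ Finset.range n, ((x + j) * Real.exp (y ^ 2 / 2 * (1 / (x + j) ^ 2))) :=
          Finset.prod_le_prod (fun _ _ => norm_nonneg _) fun j _ => hfac j
      _ = (∏ j ∈ Finset.range n, (x + j)) *
            Real.exp (y ^ 2 / 2 * ∑ j ∈ Finset.range n, 1 / (x + j) ^ 2) := by
          rw [Finset.prod_mul_distrib, ← Real.exp_sum, Finset.mul_sum]
      _ ≤ _ := by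
          have h := mul_le_mul_of_nonneg_left (hsum n) (by positivity : 0 ≤ y ^ 2 / 2)
          have h' : y ^ 2 / 2 * (2 / x) = y ^ 2 / x := by ring
          rw [h'] at h
          gcongr
  refine le_of_tendsto_of_tendsto ((Real.GammaSeq_tendsto_Gamma x).mul_const _)
    (Complex.GammaSeq_tendsto_Gamma s).norm ?_
  filter_upwards [eventually_gt_atTop 0] with n hn
  rw [Real.GammaSeq, Complex.GammaSeq, norm_div, norm_mul, norm_prod,
    Complex.norm_natCast_cpow_of_pos hn, Complex.norm_natCast, Real.exp_neg, ← div_eq_mul_inv,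
    div_div]
  have hspos : ∀ j : ℕ, 0 < ‖s + j‖ := fun j => norm_pos_iff.2 fun h => by
    have h' := congrArg Complex.re h
    simp only [Complex.add_re, Complex.natCast_re, Complex.zero_re, ← hx] at h'
    have : (0 : ℝ) ≤ j := j.cast_nonneg
    linarith
  exact div_le_div_of_nonneg_left (by positivity) (Finset.prod_pos fun j _ => hspos j) (hprod _)

/-- An exponential lower bound for the Gamma function, with arbitrary base `A`. -/
lemma Real.rpow_mul_exp_neg_le_Gamma {A x : ℝ} (hA : 0 ≤ A) (hx : 1 ≤ x) :
    A ^ (x - 1) * Real.exp (-A) ≤ Real.Gamma x := by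
  have hint := Real.GammaIntegral_convergent (s := x) (by linarith)
  rw [Real.Gamma_eq_integral (by linarith), ← integral_exp_neg_Ioi,
    ← MeasureTheory.integral_const_mul]
  calc ∫ t in Set.Ioi A, A ^ (x - 1) * Real.exp (-t)
      ≤ ∫ t in Set.Ioi A, Real.exp (-t) * t ^ (x - 1) := by
        refine MeasureTheory.setIntegral_mono_on ((integrableOn_exp_neg_Ioi A).const_mul _)
          (hint.mono_set (Set.Ioi_subset_Ioi hA)) measurableSet_Ioi fun t ht => ?_
        rw [mul_comm]
        have : A ≤ t := le_of_lt ht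
        gcongr
    _ ≤ ∫ t in Set.Ioi 0, Real.exp (-t) * t ^ (x - 1) := by
        refine MeasureTheory.setIntegral_mono_set hint ?_
          (Set.Ioi_subset_Ioi hA).eventuallyLE
        filter_upwards [MeasureTheory.ae_restrict_mem measurableSet_Ioi] with t ht
        have : 0 < t := ht
        simp only [Pi.zero_apply]
        positivity

lemma norm_prod_add_natCast_le (δ : ℂ) (k : ℕ) :
    ‖∏ i ∈ Finset.range k, (δ + i)‖ ≤ (‖δ‖ + 1) ^ k * k.factorial := by
  induction k with
  | zero => simp
  | succ k ih =>
    rw [Finset.prod_range_succ, norm_mul, pow_succ, Nat.factorial_succ]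
    have h : ‖δ + k‖ ≤ (‖δ‖ + 1) * (k + 1) := by
      refine (norm_add_le _ _).trans ?_
      rw [Complex.norm_natCast]
      nlinarith [norm_nonneg δ, (k.cast_nonneg : (0 : ℝ) ≤ k)]
    refine (mul_le_mul ih h (norm_nonneg _) (by positivity)).trans (le_of_eq ?_)
    push_cast
    ring

open Filter in
lemma summable_norm_prabTerm {ς τ : ℂ} (δ z : ℂ) (hς : 0 < ς.re) (hτ : 1 < τ.re) :
    Summable fun k => ‖prabTerm ς τ δ z k‖ := by
  set a := ς.re with ha
  set M := |ς.im| + |τ.im| with hM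
  set Q := (‖δ‖ + 1) * ‖z‖ * Real.exp (M ^ 2 / a) with hQ
  set A := (2 * Q + 1) ^ a⁻¹ with hA
  have hQ0 : 0 ≤ Q := by positivity
  have hA1 : 1 ≤ A := Real.one_le_rpow (by linarith) (by positivity)
  have hAa : A ^ a = 2 * Q + 1 := Real.rpow_inv_rpow (by linarith) hς.ne'
  have hgeom : Summable fun k : ℕ => Real.exp A * (Q / (2 * Q + 1)) ^ k :=
    (summable_geometric_of_lt_one (by positivity)
      ((div_lt_one (by linarith)).2 (by linarith))).mul_left _
  refine Summable.of_norm_bounded_eventually_nat hgeom ?_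
  have hlarge : ∀ᶠ k : ℕ in atTop, 1 ≤ a * k :=
    (tendsto_natCast_atTop_atTop.const_mul_atTop hς).eventually_ge_atTop 1
  filter_upwards [hlarge, eventually_ge_atTop 1] with k hk hk1
  have hk1' : (1 : ℝ) ≤ k := by exact_mod_cast hk1
  have hre : (ς * k + τ).re = a * k + τ.re := by simp [ha]
  have him : (ς * k + τ).im = ς.im * k + τ.im := by simp
  have hy : (ς.im * k + τ.im) ^ 2 ≤ (M * k) ^ 2 := by
    refine sq_le_sq' ?_ ?_ <;>
    nlinarith [neg_abs_le ς.im, neg_abs_le τ.im, le_abs_self ς.im, le_abs_self τ.im,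
      abs_nonneg τ.im]
  have hGamma : (2 * Q + 1) ^ k * Real.exp (-A) * (Real.exp (M ^ 2 / a) ^ k)⁻¹ ≤
      ‖Complex.Gamma (ς * k + τ)‖ := by
    refine le_trans ?_ (Complex.Gamma_re_mul_exp_le_norm_Gamma (by rw [hre]; linarith))
    rw [hre, him]
    refine mul_le_mul ?_ ?_ (by positivity) (Real.Gamma_pos_of_pos (by linarith)).le
    · refine le_trans ?_ (Real.rpow_mul_exp_neg_le_Gamma (A := A) (by linarith) (by linarith))
      rw [← hAa, ← Real.rpow_natCast, ← Real.rpow_mul (by linarith)]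
      gcongr
      linarith
    · rw [← Real.exp_nat_mul, ← Real.exp_neg]
      refine Real.exp_le_exp.2 (neg_le_neg ?_)
      calc (ς.im * k + τ.im) ^ 2 / (a * k + τ.re) ≤ (M * k) ^ 2 / (a * k) := by
            gcongr
            linarith
        _ = k * (M ^ 2 / a) := by field_simp
  rw [norm_norm, prabTerm, norm_div, norm_mul, norm_mul, norm_pow, Complex.norm_natCast]
  have hfact : (0 : ℝ) < k.factorial := by positivity
  calc _ ≤ ((‖δ‖ + 1) ^ k * k.factorial * ‖z‖ ^ k) / (k.factorial *
        ((2 * Q + 1) ^ k * Real.exp (-A) * (Real.exp (M ^ 2 / a) ^ k)⁻¹)) := by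
        gcongr
        exact norm_prod_add_natCast_le δ k
    _ = Real.exp A * (Q / (2 * Q + 1)) ^ k := by
        rw [Real.exp_neg, div_pow, hQ]
        simp only [mul_pow]
        field_simp

lemma hasDerivAt_prabTerm (ς τ δ z : ℂ) (k : ℕ) :
    HasDerivAt (fun w => prabTerm ς τ δ w k)
      ((∏ i ∈ Finset.range k, (δ + i)) * (k * z ^ (k - 1)) /
        ((k.factorial : ℂ) * Complex.Gamma (ς * k + τ))) z :=
  ((hasDerivAt_pow k z).const_mul _).div_const _

lemma prabTerm_sub_one {ς τ : ℂ} (δ z : ℂ) (hς : 0 < ς.re) (hτ : 1 < τ.re) (k : ℕ) :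
    ς * z * deriv (fun w => prabTerm ς τ δ w k) z + (τ - 1) * prabTerm ς τ δ z k =
      prabTerm ς (τ - 1) δ z k := by
  have hre : 0 < (ς * k + (τ - 1)).re := by
    have : 0 ≤ ς.re * k := by positivity
    simp
    linarith
  have hne : ς * k + (τ - 1) ≠ 0 := fun h => by simp [h] at hre
  have hG := Complex.Gamma_ne_zero_of_re_pos hre
  have hrec : Complex.Gamma (ς * k + τ) =
      (ς * k + (τ - 1)) * Complex.Gamma (ς * k + (τ - 1)) := by
    rw [← Complex.Gamma_add_one _ hne]
    ring_nf
  have hpow : z * (k * z ^ (k - 1)) = k * z ^ k := by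
    cases k with
    | zero => simp
    | succ k => rw [Nat.add_sub_cancel]; ring
  have hfact : (k.factorial : ℂ) ≠ 0 := by exact_mod_cast k.factorial_ne_zero
  rw [(hasDerivAt_prabTerm ς τ δ z k).deriv, prabTerm, prabTerm, hrec]
  field_simp
  linear_combination (∏ i ∈ Finset.range k, (δ + i)) * ς * hpow

lemma exists_hasDerivAt_cPrab {ς τ : ℂ} (δ z : ℂ) (hς : 0 < ς.re) (hτ : 1 < τ.re) :
    ∃ d, HasDerivAt (cPrab ς τ δ) d z ∧
      ς * z * d + (τ - 1) * cPrab ς τ δ z = cPrab ς (τ - 1) δ z := by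
  set U := Metric.ball (0 : ℂ) (‖z‖ + 1)
  have hz : z ∈ U := by simp [U]
  have hbound : ∀ (k : ℕ) (w : ℂ), w ∈ U →
      ‖prabTerm ς τ δ w k‖ ≤ ‖prabTerm ς τ δ ((‖z‖ + 1 : ℝ) : ℂ) k‖ := by
    intro k w hw
    have hw' : ‖w‖ ≤ ‖z‖ + 1 := (mem_ball_zero_iff.1 hw).le
    have hR : ‖((‖z‖ + 1 : ℝ) : ℂ)‖ = ‖z‖ + 1 := by
      rw [Complex.norm_real, Real.norm_of_nonneg (by positivity)]
    simp only [prabTerm, norm_div, norm_mul, norm_pow, hR]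
    gcongr
  have hsum := summable_norm_prabTerm δ ((‖z‖ + 1 : ℝ) : ℂ) hς hτ
  have hdiff : ∀ k, DifferentiableOn ℂ (fun w => prabTerm ς τ δ w k) U := fun k w _ =>
    (hasDerivAt_prabTerm ς τ δ w k).differentiableAt.differentiableWithinAt
  have hF : DifferentiableOn ℂ (cPrab ς τ δ) U :=
    Complex.differentiableOn_tsum_of_summable_norm hsum hdiff Metric.isOpen_ball hbound
  have hderiv : HasSum (fun k => deriv (fun w => prabTerm ς τ δ w k) z)
      (deriv (cPrab ς τ δ) z) :=
    Complex.hasSum_deriv_of_summable_norm hsum hdiff Metric.isOpen_ball hbound hz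
  refine ⟨_, (hF.differentiableAt (Metric.isOpen_ball.mem_nhds hz)).hasDerivAt, ?_⟩
  have hval : HasSum (prabTerm ς τ δ z) (cPrab ς τ δ z) :=
    (summable_norm_prabTerm δ z hς hτ).of_norm.hasSum
  have h := (hderiv.mul_left (ς * z)).add (hval.mul_left (τ - 1))
  simp only [prabTerm_sub_one δ z hς hτ] at h
  exact h.tsum_eq.symm

theorem prabhakar_power_deriv (ς τ δ ω : ℂ) (hς : 0 < ς.re) (hτ : 1 < τ.re)
    (z : ℝ) (hz : 0 < z) :
    deriv (fun t : ℝ => (t : ℂ) ^ (τ - 1) * cPrab ς τ δ (ω * (t : ℂ) ^ ς)) z =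
      (z : ℂ) ^ (τ - 2) * cPrab ς (τ - 1) δ (ω * (z : ℂ) ^ ς) := by
  obtain ⟨d, hd, hrel⟩ := exists_hasDerivAt_cPrab δ (ω * (z : ℂ) ^ ς) hς hτ
  have hz0 : (z : ℂ) ≠ 0 := by exact_mod_cast hz.ne'
  have hslit : (z : ℂ) ∈ Complex.slitPlane := Complex.ofReal_mem_slitPlane.2 hz
  have hpow (c : ℂ) : HasDerivAt (fun w : ℂ => w ^ c) (c * (z : ℂ) ^ (c - 1)) z :=
    (Complex.hasStrictDerivAt_cpow_const hslit).hasDerivAt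
  have hmain := ((hpow (τ - 1)).mul
    (HasDerivAt.comp (z : ℂ) hd ((hpow ς).const_mul ω))).comp_ofReal
  refine hmain.deriv.trans ?_
  have h1 : (z : ℂ) ^ (τ - 1) = (z : ℂ) ^ (τ - 2) * z := by
    rw [show τ - 1 = τ - 2 + 1 by ring, Complex.cpow_add _ _ hz0, Complex.cpow_one]
  have h2 : (z : ℂ) ^ (τ - 1 - 1) = (z : ℂ) ^ (τ - 2) := by ring_nf
  have h3 : (z : ℂ) * (z : ℂ) ^ (ς - 1) = (z : ℂ) ^ ς := by
    rw [Complex.cpow_sub _ _ hz0, Complex.cpow_one]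
    field_simp
  simp only [Function.comp_apply]
  rw [h1, h2, ← hrel]
  linear_combination (z : ℂ) ^ (τ - 2) * d * ω * ς * h3
end

section
/- Let ς > 0 be real and ω, τ, δ, s ∈ ℂ with ω ≠ 0, 0 < Re(s) < Re(δ), Re(δ) > 0, and suppose arguments are such that all integrals converge. Then the Mellin transform of the Prabhakar function satisfies ∫₀^∞ t^{s-1} E^δ_{ς,τ}(-ω t) dt = Γ(s)Γ(δ-s) ω^{-s} / (Γ(δ) Γ(τ - ςs)). -/
open Set Filter Topology MeasureTheory

/-- The rising factorial `z (z + 1) ⋯ (z + k - 1)`. -/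
noncomputable def risingFactorial (z : ℂ) (k : ℕ) : ℂ := ∏ i ∈ Finset.range k, (z + i)

lemma risingFactorial_succ (z : ℂ) (k : ℕ) :
    risingFactorial z (k + 1) = risingFactorial z k * (z + k) :=
  Finset.prod_range_succ _ _

lemma risingFactorial_add (z : ℂ) (j k : ℕ) :
    risingFactorial z (j + k) = risingFactorial z j * risingFactorial (z + j) k := by
  simp [risingFactorial, Finset.prod_range_add, add_assoc]

lemma inv_Gamma_eq_risingFactorial_mul (z : ℂ) (m : ℕ) :
    (Complex.Gamma z)⁻¹ = risingFactorial z m * (Complex.Gamma (z + m))⁻¹ := by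
  induction m with
  | zero => simp [risingFactorial]
  | succ m ih =>
    rw [ih, Complex.one_div_Gamma_eq_self_mul_one_div_Gamma_add_one, risingFactorial_succ]
    push_cast
    rw [add_assoc, mul_assoc]

lemma exists_risingFactorial_expansion (ς τ δ : ℂ) (m : ℕ) :
    ∃ c : ℕ → ℂ, (∀ x, risingFactorial (ς * x + τ) m =
      ∑ j ∈ Finset.range (m + 1), c j * risingFactorial (δ + x) j) ∧ c m = ς ^ m := by
  suffices ∃ c : ℕ → ℂ, (∀ x, risingFactorial (ς * x + τ) m =
      ∑ j ∈ Finset.range (m + 1), c j * risingFactorial (δ + x) j) ∧ c m = ς ^ m ∧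
      ∀ j, m < j → c j = 0 by
    obtain ⟨c, h1, h2, -⟩ := this
    exact ⟨c, h1, h2⟩
  induction m with
  | zero =>
    refine ⟨fun j => if j = 0 then 1 else 0, fun x => by simp [risingFactorial], by simp, ?_⟩
    intro j hj
    simp [hj.ne']
  | succ m ih =>
    obtain ⟨c, h1, h2, h3⟩ := ih
    refine ⟨fun j => (τ + m - ς * (δ + j)) * c j + if j = 0 then 0 else ς * c (j - 1),
      fun x => ?_, ?_, ?_⟩
    · rw [risingFactorial_succ, h1]
      simp_rw [add_mul]
      rw [Finset.sum_add_distrib, Finset.sum_range_succ _ (m + 1), h3 (m + 1) (by omega),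
        Finset.sum_range_succ' _ (m + 1)]
      simp only [mul_zero, zero_mul, add_zero, if_true, Nat.add_sub_cancel, Nat.succ_ne_zero,
        if_false]
      rw [← Finset.sum_add_distrib, Finset.sum_mul]
      refine Finset.sum_congr rfl fun j _ => ?_
      rw [risingFactorial_succ]
      ring
    · simp [h3 (m + 1) (by omega), h2, pow_succ']
    · intro j hj
      have : j ≠ 0 := by omega
      simp [h3 j (by omega), h3 (j - 1) (by omega)]

lemma choose_eq_risingFactorial_div (δ : ℂ) (n : ℕ) :
    Ring.choose (δ + n - 1) n = risingFactorial δ n / n.factorial := by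
  rw [← Ring.multichoose_eq, eq_div_iff (by exact_mod_cast n.factorial_ne_zero), mul_comm,
    ← nsmul_eq_mul, Ring.factorial_nsmul_multichoose_eq_ascPochhammer,
    Polynomial.ascPochhammer_smeval_eq_eval]
  induction n with
  | zero => simp [risingFactorial]
  | succ n ih => rw [risingFactorial_succ, ascPochhammer_succ_eval, ih]

lemma one_sub_cpow_neg_series (δ : ℂ) {x : ℂ} (hx : ‖x‖ < 1) :
    HasSum (fun k : ℕ => risingFactorial δ k / k.factorial * x ^ k) ((1 - x) ^ (-δ)) ∧
      Summable fun k : ℕ => ‖risingFactorial δ k / k.factorial * x ^ k‖ := by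
  have h := Complex.one_div_one_sub_cpow_hasFPowerSeriesOnBall_zero δ
  have hx' : x ∈ Metric.eball (0 : ℂ) 1 := by
    simpa [enorm_eq_nnnorm, ← NNReal.coe_lt_coe] using hx
  constructor
  · have := h.hasSum hx'
    simpa [choose_eq_risingFactorial_div, Complex.cpow_neg, mul_comm] using this
  · have := h.r_le
    have h2 := FormalMultilinearSeries.summable_norm_apply _
      (Metric.eball_subset_eball this hx')
    simpa [choose_eq_risingFactorial_div, mul_comm] using h2

lemma risingFactorial_series {ς τ δ : ℂ} {m : ℕ} {c : ℕ → ℂ}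
    (hc : ∀ x, risingFactorial (ς * x + τ) m =
      ∑ j ∈ Finset.range (m + 1), c j * risingFactorial (δ + x) j) {x : ℂ} (hx : ‖x‖ < 1) :
    HasSum (fun k : ℕ => risingFactorial δ k / k.factorial * x ^ k *
        risingFactorial (ς * k + τ) m)
      (∑ j ∈ Finset.range (m + 1), c j * risingFactorial δ j * (1 - x) ^ (-(δ + j))) ∧
      Summable fun k : ℕ => ‖risingFactorial δ k / k.factorial * x ^ k *
        risingFactorial (ς * k + τ) m‖ := by
  have key : ∀ k : ℕ, risingFactorial δ k / k.factorial * x ^ k *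
      risingFactorial (ς * k + τ) m = ∑ j ∈ Finset.range (m + 1), c j * risingFactorial δ j *
        (risingFactorial (δ + j) k / k.factorial * x ^ k) := fun k => by
    rw [hc, Finset.mul_sum]
    refine Finset.sum_congr rfl fun j _ => ?_
    have := risingFactorial_add δ j k
    rw [add_comm j k, risingFactorial_add] at this
    linear_combination (c j * x ^ k / k.factorial) * this
  simp_rw [key]
  refine ⟨hasSum_sum fun j _ => (one_sub_cpow_neg_series (δ + j) hx).1.mul_left _, ?_⟩
  refine Summable.of_nonneg_of_le (fun _ => norm_nonneg _) (fun k => norm_sum_le _ _)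
    (summable_sum fun j _ => ?_)
  simp_rw [norm_mul (c j * risingFactorial δ j)]
  exact (one_sub_cpow_neg_series (δ + j) hx).2.mul_left _

lemma norm_betaIntegral_le {u : ℂ} {v : ℝ} (hu : 0 < u.re) (hv : 0 < v) :
    ‖Complex.betaIntegral u v‖ ≤ Real.Gamma u.re * Real.Gamma v / Real.Gamma (u.re + v) := by
  have h1 := Complex.Gamma_mul_Gamma_eq_betaIntegral (s := (u.re : ℂ)) (t := v)
    (by simpa) (by simpa)
  have h2 : ‖Complex.betaIntegral u v‖ ≤
      ∫ x in (0:ℝ)..1, x ^ (u.re - 1) * (1 - x) ^ (v - 1) := by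
    refine intervalIntegral.norm_integral_le_of_norm_le zero_le_one ?_ ?_
    · filter_upwards [compl_mem_ae_iff.mpr (measure_singleton (1 : ℝ))] with x hx1 hx
      have hx1 : x < 1 := lt_of_le_of_ne hx.2 hx1
      rw [norm_mul, Complex.norm_cpow_eq_rpow_re_of_pos hx.1, ← Complex.ofReal_one,
        ← Complex.ofReal_sub, Complex.norm_cpow_eq_rpow_re_of_pos (by linarith)]
      simp
    · have := (Complex.betaIntegral_convergent (u := (u.re : ℂ)) (v := v)
        (by simpa) (by simpa)).norm
      rw [intervalIntegrable_iff_integrableOn_Ioo_of_le zero_le_one] at this ⊢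
      refine this.congr_fun (fun x hx => ?_) measurableSet_Ioo
      have h1x : (1 : ℂ) - x = ((1 - x : ℝ) : ℂ) := by push_cast; rfl
      simp only [norm_mul]
      rw [Complex.norm_cpow_eq_rpow_re_of_pos hx.1, h1x,
        Complex.norm_cpow_eq_rpow_re_of_pos (by linarith [hx.2])]
      simp
  have h3 : Complex.betaIntegral (u.re : ℂ) v =
      ((∫ x in (0:ℝ)..1, x ^ (u.re - 1) * (1 - x) ^ (v - 1) : ℝ) : ℂ) := by
    rw [Complex.betaIntegral, ← intervalIntegral.integral_ofReal]
    refine intervalIntegral.integral_congr fun x hx => ?_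
    rw [uIcc_of_le zero_le_one] at hx
    push_cast [Complex.ofReal_cpow hx.1, Complex.ofReal_cpow (sub_nonneg.2 hx.2)]
    rfl
  rw [h3, Complex.Gamma_ofReal, Complex.Gamma_ofReal, ← Complex.ofReal_add,
    Complex.Gamma_ofReal] at h1
  have h4 : Real.Gamma u.re * Real.Gamma v = Real.Gamma (u.re + v) *
    ∫ x in (0:ℝ)..1, x ^ (u.re - 1) * (1 - x) ^ (v - 1) := by exact_mod_cast h1
  have := (Real.Gamma_pos_of_pos (add_pos hu hv))
  rw [h4, mul_div_cancel_left₀ _ this.ne']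
  exact h2

/-- Moving to the right, `|Γ|` grows at least as fast as `Γ` does on the real axis. -/
lemma Gamma_re_add_le {u : ℂ} {v : ℝ} (hu : 0 < u.re) (hv : 0 ≤ v) :
    ‖Complex.Gamma u‖ * Real.Gamma (u.re + v) ≤
      Real.Gamma u.re * ‖Complex.Gamma (u + v)‖ := by
  rcases hv.eq_or_lt with rfl | hv
  · simp [mul_comm]
  have h1 := congrArg norm (Complex.Gamma_mul_Gamma_eq_betaIntegral (s := u) (t := v) hu (by simpa))
  have hΓ := Real.Gamma_pos_of_pos hv
  have hΓ' := Real.Gamma_pos_of_pos (add_pos hu hv)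
  rw [norm_mul, norm_mul, Complex.Gamma_ofReal, Complex.norm_real, Real.norm_of_nonneg hΓ.le] at h1
  have h2 := mul_le_mul_of_nonneg_left (norm_betaIntegral_le hu hv)
    (norm_nonneg (Complex.Gamma (u + v)))
  rw [← h1] at h2
  rw [mul_div_assoc', le_div_iff₀ hΓ'] at h2
  nlinarith

lemma rpow_mul_exp_neg_le {c ε t : ℝ} (hc : 0 < c) (hε : 0 < ε) (ht : 0 ≤ t) :
    t ^ c * Real.exp (-(ε * t)) ≤ (c / ε) ^ c := by
  have h1 : ε * t / c ≤ Real.exp (ε * t / c) := by linarith [Real.add_one_le_exp (ε * t / c)]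
  have h2 : t ≤ c / ε * Real.exp (ε * t / c) := by
    calc t = c / ε * (ε * t / c) := by field_simp
      _ ≤ _ := by gcongr
  have h3 : t ^ c ≤ (c / ε * Real.exp (ε * t / c)) ^ c := Real.rpow_le_rpow ht h2 hc.le
  rw [Real.mul_rpow (by positivity) (Real.exp_pos _).le, ← Real.exp_mul,
    div_mul_cancel₀ _ hc.ne'] at h3
  calc t ^ c * Real.exp (-(ε * t))
      ≤ (c / ε) ^ c * Real.exp (ε * t) * Real.exp (-(ε * t)) := by gcongr
    _ = (c / ε) ^ c := by rw [mul_assoc, ← Real.exp_add]; simp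

lemma norm_cpow_mul_exp_neg {b p : ℂ} {t : ℝ} (ht : 0 < t) :
    ‖(t : ℂ) ^ b * Complex.exp (-(p * t))‖ = t ^ b.re * Real.exp (-(p.re * t)) := by
  rw [norm_mul, Complex.norm_cpow_eq_rpow_re_of_pos ht, Complex.norm_exp]
  simp

lemma measurable_cpow_mul_exp_neg (b p : ℂ) :
    Measurable fun t : ℝ => (t : ℂ) ^ b * Complex.exp (-(p * t)) :=
  (Complex.measurable_ofReal.pow_const b).mul (by fun_prop)

lemma integrableOn_mul_cpow_mul_exp_neg {F : ℝ → ℂ} (hF : IntegrableOn F (Ioi 0)) {b p : ℂ}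
    (hb : 0 < b.re) (hp : 0 < p.re) :
    IntegrableOn (fun t : ℝ => F t * ((t : ℂ) ^ b * Complex.exp (-(p * t)))) (Ioi 0) := by
  refine Integrable.mul_bdd (c := (b.re / p.re) ^ b.re) hF
    (measurable_cpow_mul_exp_neg b p).aestronglyMeasurable ?_
  filter_upwards [ae_restrict_mem measurableSet_Ioi] with t ht
  rw [norm_cpow_mul_exp_neg ht]
  exact rpow_mul_exp_neg_le hb hp (le_of_lt ht)

lemma differentiableAt_laplace {F : ℝ → ℂ} (hF : IntegrableOn F (Ioi 0)) {b p : ℂ}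
    (hb : 0 < b.re) (hp : 0 < p.re) :
    DifferentiableAt ℂ
      (fun p : ℂ => ∫ t in Ioi (0 : ℝ), F t * ((t : ℂ) ^ b * Complex.exp (-(p * t)))) p := by
  have hs : {z : ℂ | p.re / 2 < z.re} ∈ 𝓝 p :=
    (isOpen_lt continuous_const Complex.continuous_re).mem_nhds (by simp; linarith)
  have hb1 : 0 < (b + 1).re := by simp; linarith
  refine (hasDerivAt_integral_of_dominated_loc_of_deriv_le (μ := volume.restrict (Ioi 0))
    (F := fun p t => F t * ((t : ℂ) ^ b * Complex.exp (-(p * t))))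
    (F' := fun p t => F t * (-((t : ℂ) ^ (b + 1) * Complex.exp (-(p * t)))))
    (bound := fun t => ‖F t‖ * ((b + 1).re / (p.re / 2)) ^ (b + 1).re) hs ?_
    (integrableOn_mul_cpow_mul_exp_neg hF hb hp) ?_ ?_ ?_ ?_).2.differentiableAt
  · exact .of_forall fun z => hF.1.mul (measurable_cpow_mul_exp_neg b z).aestronglyMeasurable
  · exact hF.1.mul (measurable_cpow_mul_exp_neg (b + 1) p).neg.aestronglyMeasurable
  · filter_upwards [ae_restrict_mem measurableSet_Ioi] with t ht z hz
    rw [norm_mul, norm_neg, norm_cpow_mul_exp_neg ht]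
    gcongr
    refine le_trans ?_ (rpow_mul_exp_neg_le hb1 (half_pos hp) (le_of_lt ht))
    have ht0 : (0 : ℝ) < t := ht
    have hz' : p.re / 2 < z.re := hz
    gcongr
  · exact hF.norm.mul_const _
  · filter_upwards [ae_restrict_mem measurableSet_Ioi] with t ht z _
    have ht0 : (t : ℂ) ≠ 0 := Complex.ofReal_ne_zero.2 (ne_of_gt ht)
    have h : HasDerivAt (fun z : ℂ => Complex.exp (-(z * t)))
        (Complex.exp (-(z * t)) * -(1 * (t : ℂ))) z :=
      (((hasDerivAt_id z).mul_const (t : ℂ)).neg).cexp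
    convert! (h.const_mul ((t : ℂ) ^ b)).const_mul (F t) using 1
    rw [Complex.cpow_add _ _ ht0, Complex.cpow_one]
    ring

lemma integrable_mellin_laplace_kernel {F : ℝ → ℂ} (hF : IntegrableOn F (Ioi 0)) {b : ℂ}
    (hb : 0 < b.re) :
    Integrable (fun x : ℝ × ℝ =>
      (x.1 : ℂ) ^ (b - 1) * (F x.2 * ((x.2 : ℂ) ^ b * Complex.exp (-(x.1 * x.2)))))
      ((volume.restrict (Ioi 0)).prod (volume.restrict (Ioi 0))) := by
  have hnorm : ∀ t ∈ Ioi (0 : ℝ), ∀ p ∈ Ioi (0 : ℝ),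
      ‖(p : ℂ) ^ (b - 1) * (F t * ((t : ℂ) ^ b * Complex.exp (-(p * t))))‖ =
      (‖F t‖ * t ^ b.re) * (p ^ (b.re - 1) * Real.exp (-(t * p))) := fun t ht p hp => by
    rw [norm_mul, norm_mul, norm_cpow_mul_exp_neg ht, Complex.norm_cpow_eq_rpow_re_of_pos hp]
    simp only [Complex.sub_re, Complex.one_re, Complex.ofReal_re]
    rw [mul_comm p t]
    ring
  have hmeas : AEStronglyMeasurable (fun x : ℝ × ℝ =>
      (x.1 : ℂ) ^ (b - 1) * (F x.2 * ((x.2 : ℂ) ^ b * Complex.exp (-(x.1 * x.2)))))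
      ((volume.restrict (Ioi 0)).prod (volume.restrict (Ioi 0))) := by
    refine AEStronglyMeasurable.mul (Measurable.aestronglyMeasurable ?_)
      (hF.1.comp_snd.mul (Measurable.aestronglyMeasurable ?_))
    · exact (Complex.measurable_ofReal.comp measurable_fst).pow_const _
    · exact ((Complex.measurable_ofReal.comp measurable_snd).pow_const _).mul (by fun_prop)
  rw [integrable_prod_iff' hmeas]
  constructor
  · filter_upwards [ae_restrict_mem measurableSet_Ioi] with t ht
    refine (integrable_norm_iff ?_).1 ?_
    · refine Measurable.aestronglyMeasurable ?_
      exact (Complex.measurable_ofReal.pow_const _).mul (by fun_prop)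
    · have h := (integrableOn_rpow_mul_exp_neg_mul_rpow (s := b.re - 1) (p := 1) (b := t)
        (by linarith) one_pos ht).const_mul (‖F t‖ * t ^ b.re)
      refine IntegrableOn.congr_fun h (fun p hp => ?_) measurableSet_Ioi
      rw [hnorm t ht p hp]
      simp
  · refine (hF.norm.mul_const (Real.Gamma b.re)).congr ?_
    filter_upwards [ae_restrict_mem measurableSet_Ioi] with t ht
    have ht0 : (0 : ℝ) < t := ht
    rw [setIntegral_congr_fun measurableSet_Ioi (hnorm t ht), integral_const_mul,
      Real.integral_rpow_mul_exp_neg_mul_Ioi hb ht, Real.div_rpow zero_le_one ht0.le,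
      Real.one_rpow]
    have := Real.rpow_pos_of_pos ht0 b.re
    field_simp

/-- The Mellin transform of a Laplace transform. -/
lemma mellin_laplace {F : ℝ → ℂ} (hF : IntegrableOn F (Ioi 0)) {b : ℂ} (hb : 0 < b.re) :
    MellinConvergent
      (fun p : ℝ => ∫ t in Ioi (0 : ℝ), F t * ((t : ℂ) ^ b * Complex.exp (-(p * t)))) b ∧
    mellin (fun p : ℝ => ∫ t in Ioi (0 : ℝ), F t * ((t : ℂ) ^ b * Complex.exp (-(p * t)))) b =
      Complex.Gamma b * ∫ t in Ioi (0 : ℝ), F t := by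
  have h := integrable_mellin_laplace_kernel hF hb
  simp_rw [MellinConvergent, mellin, smul_eq_mul, ← integral_const_mul]
  refine ⟨h.integral_prod_left, ?_⟩
  rw [integral_integral_swap h]
  refine setIntegral_congr_fun measurableSet_Ioi fun t ht => ?_
  have ht0 : (t : ℂ) ≠ 0 := Complex.ofReal_ne_zero.2 (ne_of_gt ht)
  have : ∀ p : ℝ, (p : ℂ) ^ (b - 1) * (F t * ((t : ℂ) ^ b * Complex.exp (-(p * t)))) =
      F t * (t : ℂ) ^ b * ((p : ℂ) ^ (b - 1) * Complex.exp (-(t * p))) := fun p => by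
    rw [mul_comm (p : ℂ) t]; ring
  simp_rw [this]
  rw [integral_const_mul, Complex.integral_cpow_mul_exp_neg_mul_Ioi hb ht, one_div,
    Complex.inv_cpow _ _ (by simp [Complex.arg_ofReal_of_nonneg (le_of_lt ht), Real.pi_ne_zero.symm])]
  have : (t : ℂ) ^ b ≠ 0 := by simp [Complex.cpow_eq_zero_iff, ht0]
  field_simp

lemma one_add_mul_mem_slitPlane {ω : ℂ} (hω : ω ∈ Complex.slitPlane) {q : ℝ} (hq : 0 ≤ q) :
    1 + ω * q ∈ Complex.slitPlane := by
  rw [Complex.mem_slitPlane_iff] at *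
  rcases hq.eq_or_lt with rfl | hq
  · simp
  rcases hω with h | h
  · left
    simp
    positivity
  · right
    simp [h, hq.ne']

lemma exists_le_norm_one_add_mul {ω : ℂ} (hω : ω ∈ Complex.slitPlane) :
    ∃ c > 0, ∀ z ∈ Metric.ball ω c, ∀ q : ℝ, 0 ≤ q → c * (1 + q) ≤ ‖1 + z * q‖ := by
  obtain ⟨θ₀, hθ₀, hmin⟩ := (isCompact_Icc (a := (0 : ℝ)) (b := 1)).exists_isMinOn
    (f := fun θ : ℝ => ‖(1 - θ : ℂ) + θ * ω‖) (nonempty_Icc.2 zero_le_one) (by fun_prop)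
  have hpos : 0 < ‖(1 - θ₀ : ℂ) + θ₀ * ω‖ := by
    have h := Complex.starConvex_one_slitPlane hω (sub_nonneg.2 hθ₀.2) hθ₀.1 (by ring)
    refine norm_pos_iff.2 (Complex.slitPlane_ne_zero ?_)
    simpa using h
  refine ⟨_, half_pos hpos, fun z hz q hq => ?_⟩
  have hq1 : (0 : ℝ) < 1 + q := by linarith
  have hq1' : (1 + q : ℂ) ≠ 0 := by exact_mod_cast hq1.ne'
  set θ := q / (1 + q) with hθ
  have hθ0 : 0 ≤ θ := by positivity
  have hθ1 : θ ≤ 1 := by rw [hθ, div_le_one hq1]; linarith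
  have h1 : ‖(1 - θ₀ : ℂ) + θ₀ * ω‖ ≤ ‖(1 - θ : ℂ) + θ * ω‖ := hmin ⟨hθ0, hθ1⟩
  have h2 : (1 + z * q : ℂ) = ((1 + q : ℝ) : ℂ) * ((1 - θ : ℂ) + θ * z) := by
    rw [hθ]
    push_cast
    field_simp
    ring
  have h3 : ‖(1 - θ : ℂ) + θ * ω‖ ≤ ‖(1 - θ : ℂ) + θ * z‖ + ‖z - ω‖ := by
    have : (1 - θ : ℂ) + θ * ω = ((1 - θ : ℂ) + θ * z) - θ * (z - ω) := by ring
    rw [this]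
    refine (norm_sub_le _ _).trans ?_
    rw [norm_mul, Complex.norm_real, Real.norm_of_nonneg hθ0]
    gcongr
    exact mul_le_of_le_one_left (norm_nonneg _) hθ1
  rw [mem_ball_iff_norm] at hz
  rw [h2, norm_mul, Complex.norm_real, Real.norm_of_nonneg hq1.le, mul_comm]
  gcongr
  linarith

lemma norm_cpow_neg_le {z δ : ℂ} {r : ℝ} (hr : 0 < r) (hδ : 0 < δ.re) (hz : r ≤ ‖z‖) :
    ‖z ^ (-δ)‖ ≤ Real.exp (Real.pi * |δ.im|) * r ^ (-δ.re) := by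
  have hz0 : z ≠ 0 := norm_pos_iff.1 (hr.trans_le hz)
  rw [Complex.norm_cpow_of_ne_zero hz0, div_eq_mul_inv, ← Real.exp_neg, mul_comm]
  have h1 : -(z.arg * (-δ).im) ≤ Real.pi * |δ.im| := by
    rw [Complex.neg_im, mul_neg, neg_neg]
    refine (le_abs_self _).trans ?_
    rw [abs_mul]
    gcongr
    exact Complex.abs_arg_le_pi z
  have h2 : ‖z‖ ^ (-δ).re ≤ r ^ (-δ.re) :=
    Real.rpow_le_rpow_of_nonpos hr hz (by rw [Complex.neg_re]; linarith)
  gcongr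

lemma mellin_one_add_cpow {s δ : ℂ} (hs : 0 < s.re) (hsδ : s.re < δ.re) :
    MellinConvergent (fun q : ℝ => (1 + q : ℂ) ^ (-δ)) s ∧
    mellin (fun q : ℝ => (1 + q : ℂ) ^ (-δ)) s =
      Complex.Gamma s * Complex.Gamma (δ - s) / Complex.Gamma δ := by
  have hδs : 0 < (δ - s).re := by simpa using hsδ
  have hδ : 0 < δ.re := hs.trans hsδ
  have hF := Complex.GammaIntegral_convergent hδs
  obtain ⟨h1, h2⟩ := mellin_laplace hF hs
  have hΓ := Complex.Gamma_ne_zero_of_re_pos hδ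
  have key : ∀ q ∈ Ioi (0 : ℝ), (∫ t in Ioi (0 : ℝ),
      ((Real.exp (-t) : ℝ) : ℂ) * (t : ℂ) ^ (δ - s - 1) *
      ((t : ℂ) ^ s * Complex.exp (-(q * t)))) = Complex.Gamma δ • (1 + q : ℂ) ^ (-δ) := by
    intro q hq
    have hq0 : (0 : ℝ) < 1 + q := by have : (0 : ℝ) < q := hq; linarith
    have := Complex.integral_cpow_mul_exp_neg_mul_Ioi hδ hq0
    rw [one_div, Complex.inv_cpow _ _ (by
        rw [Complex.arg_ofReal_of_nonneg hq0.le]; exact Real.pi_ne_zero.symm),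
      ← Complex.cpow_neg] at this
    push_cast at this
    rw [smul_eq_mul, mul_comm (Complex.Gamma δ), ← this]
    refine setIntegral_congr_fun measurableSet_Ioi fun t ht => ?_
    have ht0 : (t : ℂ) ≠ 0 := Complex.ofReal_ne_zero.2 (ne_of_gt ht)
    rw [show δ - 1 = (δ - s - 1) + s by ring, Complex.cpow_add _ _ ht0,
      show -((1 + (q : ℂ)) * t) = -t + -(q * t) by ring, Complex.exp_add]
    push_cast
    ring
  have h1' : MellinConvergent (fun q : ℝ => Complex.Gamma δ • (1 + q : ℂ) ^ (-δ)) s :=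
    IntegrableOn.congr_fun h1 (fun q hq => congrArg _ (key q hq)) measurableSet_Ioi
  have h2' : mellin (fun q : ℝ => Complex.Gamma δ • (1 + q : ℂ) ^ (-δ)) s =
      Complex.Gamma s * Complex.Gamma (δ - s) := by
    rw [Complex.Gamma_eq_integral hδs, Complex.GammaIntegral, ← h2]
    exact setIntegral_congr_fun measurableSet_Ioi fun q hq => congrArg _ (key q hq).symm
  rw [mellin_const_smul, smul_eq_mul] at h2'
  refine ⟨?_, by rw [← h2']; field_simp⟩
  have := h1'.const_smul (Complex.Gamma δ)⁻¹
  simpa [smul_smul, hΓ] using this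

lemma measurable_cpow_mul_one_add_mul_cpow (s δ ω : ℂ) :
    Measurable fun q : ℝ => (q : ℂ) ^ s * (1 + ω * q) ^ δ :=
  (Complex.measurable_ofReal.pow_const _).mul (Measurable.pow_const (by fun_prop) _)

lemma integrableOn_rpow_mul_one_add_rpow {σ d : ℝ} (hσ : 0 < σ) (hσd : σ < d) :
    IntegrableOn (fun q : ℝ => q ^ (σ - 1) * (1 + q) ^ (-d)) (Ioi 0) := by
  have h := (mellin_one_add_cpow (s := σ) (δ := d) (by simpa) (by simpa)).1
  refine IntegrableOn.congr_fun h.norm (fun q hq => ?_) measurableSet_Ioi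
  have hq0 : (0 : ℝ) < 1 + q := by have : (0 : ℝ) < q := hq; linarith
  dsimp only
  rw [norm_smul, Complex.norm_cpow_eq_rpow_re_of_pos hq, ← Complex.ofReal_one,
    ← Complex.ofReal_add, Complex.norm_cpow_eq_rpow_re_of_pos hq0]
  simp

lemma mellinConvergent_and_differentiableAt_one_add_mul_cpow {s δ ω : ℂ} (hs : 0 < s.re)
    (hsδ : s.re < δ.re)
    (hω : ω ∈ Complex.slitPlane) :
    MellinConvergent (fun q : ℝ => (1 + ω * q) ^ (-δ)) s ∧
    DifferentiableAt ℂ (fun ω : ℂ => mellin (fun q : ℝ => (1 + ω * q) ^ (-δ)) s) ω := by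
  have hδ : 0 < δ.re := hs.trans hsδ
  obtain ⟨c, hc, hbd⟩ := exists_le_norm_one_add_mul hω
  have hB := integrableOn_rpow_mul_one_add_rpow hs hsδ
  have hbound : ∀ (e : ℂ), 0 < e.re → ∀ z ∈ Metric.ball ω c, ∀ q : ℝ, 0 < q →
      ‖(1 + z * q) ^ (-e)‖ ≤
        Real.exp (Real.pi * |e.im|) * c ^ (-e.re) * (1 + q) ^ (-e.re) := fun e he z hz q hq => by
    refine (norm_cpow_neg_le (by positivity) he (hbd z hz q hq.le)).trans_eq ?_
    rw [Real.mul_rpow hc.le (by linarith)]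
    ring
  have hint : ∀ z ∈ Metric.ball ω c,
      IntegrableOn (fun q : ℝ => (q : ℂ) ^ (s - 1) * (1 + z * q) ^ (-δ)) (Ioi 0) := by
    intro z hz
    refine Integrable.mono' (hB.const_mul (Real.exp (Real.pi * |δ.im|) * c ^ (-δ.re)))
      (measurable_cpow_mul_one_add_mul_cpow _ _ _).aestronglyMeasurable ?_
    filter_upwards [ae_restrict_mem measurableSet_Ioi] with q hq
    rw [norm_mul, Complex.norm_cpow_eq_rpow_re_of_pos hq, Complex.sub_re, Complex.one_re,
      mul_left_comm]
    have hq0 : (0 : ℝ) < q := hq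
    gcongr
    exact hbound δ hδ z hz q hq
  refine ⟨hint ω (Metric.mem_ball_self hc), ?_⟩
  have hδ1 : 0 < (δ + 1).re := by simp; linarith
  refine (hasDerivAt_integral_of_dominated_loc_of_deriv_le (μ := volume.restrict (Ioi 0))
    (F := fun z q => (q : ℂ) ^ (s - 1) * (1 + z * q) ^ (-δ))
    (F' := fun z q => (-δ * q) * ((q : ℂ) ^ (s - 1) * (1 + z * q) ^ (-(δ + 1))))
    (bound := fun q => ‖δ‖ * (Real.exp (Real.pi * |(δ + 1).im|) * c ^ (-(δ + 1).re)) *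
      (q ^ (s.re - 1) * (1 + q) ^ (-δ.re)))
    (Filter.inter_mem (Metric.ball_mem_nhds ω hc) (Complex.isOpen_slitPlane.mem_nhds hω))
    ?_ (hint ω (Metric.mem_ball_self hc)) ?_ ?_ ?_ ?_).2.differentiableAt
  · exact .of_forall fun z => (measurable_cpow_mul_one_add_mul_cpow _ _ _).aestronglyMeasurable
  · refine AEStronglyMeasurable.mul (Measurable.aestronglyMeasurable (by fun_prop))
      (measurable_cpow_mul_one_add_mul_cpow _ _ _).aestronglyMeasurable
  · filter_upwards [ae_restrict_mem measurableSet_Ioi] with q hq z hz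
    have hq0 : (0 : ℝ) < q := hq
    have hq1 : (0 : ℝ) < 1 + q := by linarith
    rw [norm_mul, norm_mul, norm_mul, norm_neg, Complex.norm_cpow_eq_rpow_re_of_pos hq,
      Complex.norm_real, Real.norm_of_nonneg hq0.le, Complex.sub_re, Complex.one_re]
    have h1 := hbound (δ + 1) hδ1 z hz.1 q hq
    have h2 : q * (1 + q) ^ (-(δ + 1).re) ≤ (1 + q) ^ (-δ.re) := by
      have : -δ.re = 1 + -(δ + 1).re := by simp
      rw [this, Real.rpow_add hq1, Real.rpow_one]
      gcongr
      linarith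
    calc ‖δ‖ * q * (q ^ (s.re - 1) * ‖(1 + z * q) ^ (-(δ + 1))‖)
        ≤ ‖δ‖ * q * (q ^ (s.re - 1) * (Real.exp (Real.pi * |(δ + 1).im|) *
          c ^ (-(δ + 1).re) * (1 + q) ^ (-(δ + 1).re))) := by gcongr
      _ = ‖δ‖ * (Real.exp (Real.pi * |(δ + 1).im|) * c ^ (-(δ + 1).re)) *
          (q ^ (s.re - 1) * (q * (1 + q) ^ (-(δ + 1).re))) := by ring
      _ ≤ _ := by gcongr
  · exact hB.const_mul _
  · filter_upwards [ae_restrict_mem measurableSet_Ioi] with q hq z hz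
    have h : HasDerivAt (fun z : ℂ => 1 + z * q) (1 * (q : ℂ)) z :=
      ((hasDerivAt_id z).mul_const (q : ℂ)).const_add 1
    convert! (h.cpow_const (c := -δ) (one_add_mul_mem_slitPlane hz.2 (le_of_lt hq))).const_mul
      ((q : ℂ) ^ (s - 1)) using 1
    rw [neg_add, ← sub_eq_add_neg]
    ring

lemma mellin_one_add_mul_cpow {s δ ω : ℂ} (hs : 0 < s.re) (hsδ : s.re < δ.re)
    (hω : ω ∈ Complex.slitPlane) :
    mellin (fun q : ℝ => (1 + ω * q) ^ (-δ)) s =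
      ω ^ (-s) * (Complex.Gamma s * Complex.Gamma (δ - s) / Complex.Gamma δ) := by
  have hf : AnalyticOnNhd ℂ (fun ω : ℂ => mellin (fun q : ℝ => (1 + ω * q) ^ (-δ)) s)
      Complex.slitPlane :=
    DifferentiableOn.analyticOnNhd (fun z hz =>
      (mellinConvergent_and_differentiableAt_one_add_mul_cpow hs hsδ hz).2.differentiableWithinAt) Complex.isOpen_slitPlane
  have hg : AnalyticOnNhd ℂ (fun ω : ℂ => ω ^ (-s) *
      (Complex.Gamma s * Complex.Gamma (δ - s) / Complex.Gamma δ)) Complex.slitPlane :=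
    DifferentiableOn.analyticOnNhd (fun z hz =>
      ((differentiableAt_id.cpow_const hz).mul_const _).differentiableWithinAt)
      Complex.isOpen_slitPlane
  have hpre : IsPreconnected Complex.slitPlane :=
    (Complex.starConvex_one_slitPlane.isPathConnected Complex.one_mem_slitPlane
      ).isConnected.isPreconnected
  refine hf.eqOn_of_preconnected_of_frequently_eq hg hpre Complex.one_mem_slitPlane ?_ hω
  have hreal : ∀ a : ℝ, 0 < a → mellin (fun q : ℝ => (1 + (a : ℂ) * q) ^ (-δ)) s =
      (a : ℂ) ^ (-s) * (Complex.Gamma s * Complex.Gamma (δ - s) / Complex.Gamma δ) := by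
    intro a ha
    rw [← (mellin_one_add_cpow hs hsδ).2, ← smul_eq_mul, ← mellin_comp_mul_left _ _ ha]
    simp
  have htend : Tendsto (fun a : ℝ => (a : ℂ)) (𝓝[>] 1) (𝓝[≠] 1) := by
    refine tendsto_nhdsWithin_iff.2 ⟨?_, ?_⟩
    · exact (Complex.continuous_ofReal.tendsto' 1 1 (by simp)).mono_left nhdsWithin_le_nhds
    · filter_upwards [self_mem_nhdsWithin] with a ha
      have : a ≠ 1 := ne_of_gt ha
      simpa using this
  refine htend.frequently (Eventually.frequently ?_)
  filter_upwards [self_mem_nhdsWithin] with a ha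
  exact hreal a (one_pos.trans ha)

lemma Gamma_re_add_div_le {ς : ℝ} (hς : 0 < ς) {τ : ℂ} {m : ℕ} (ha : 0 < (τ + m).re)
    (k : ℕ) : Real.Gamma ((τ + m).re + ς * k) / ‖Complex.Gamma (ς * k + τ)‖ ≤
      Real.Gamma (τ + m).re / ‖Complex.Gamma (τ + m)‖ *
        ‖risingFactorial (ς * k + τ) m‖ := by
  have hv : 0 ≤ ς * k := by positivity
  have h1 := Gamma_re_add_le ha hv
  have h2 := congrArg norm (inv_Gamma_eq_risingFactorial_mul (ς * k + τ) m)
  have e : (ς * k + τ + m : ℂ) = τ + m + (ς * k : ℝ) := by push_cast; ring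
  have hΓ : 0 < ‖Complex.Gamma (τ + m + (ς * k : ℝ))‖ :=
    norm_pos_iff.2 (Complex.Gamma_ne_zero_of_re_pos
      (by rw [Complex.add_re, Complex.ofReal_re]; linarith))
  have hΓ0 : 0 < ‖Complex.Gamma (τ + m)‖ :=
    norm_pos_iff.2 (Complex.Gamma_ne_zero_of_re_pos ha)
  rw [norm_inv, norm_mul, norm_inv, e] at h2
  rw [div_eq_mul_inv, h2]
  rw [← le_div_iff₀' hΓ0] at h1
  calc _ ≤ Real.Gamma (τ + m).re * ‖Complex.Gamma (τ + m + (ς * k : ℝ))‖ / ‖Complex.Gamma (τ + m)‖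
          * (‖risingFactorial (ς * k + τ) m‖ * ‖Complex.Gamma (τ + m + (ς * k : ℝ))‖⁻¹) := by
        gcongr
    _ = _ := by field_simp

lemma laplace_cPrab {ς : ℝ} (hς : 0 < ς) (ω δ : ℂ) {τ : ℂ} {m : ℕ} (ha : 0 < (τ + m).re)
    {c : ℕ → ℂ} (hc : ∀ x, risingFactorial (ς * x + τ) m =
      ∑ j ∈ Finset.range (m + 1), c j * risingFactorial (δ + x) j)
    {p : ℝ} (hp : 0 < p) (hωp : ‖ω‖ < p ^ ς) :
    ∫ t in Ioi (0 : ℝ), (t : ℂ) ^ (τ + m - 1) * Complex.exp (-(p * t)) *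
        cPrab ς τ δ (-(ω * (t ^ ς : ℝ))) =
      (p : ℂ) ^ (-(τ + m)) * ∑ j ∈ Finset.range (m + 1),
        c j * risingFactorial δ j * (1 + ω * (p ^ (-ς) : ℝ)) ^ (-(δ + j)) := by
  set a := τ + m with ha_def
  set x : ℂ := -ω * (p ^ (-ς) : ℝ) with hx_def
  have hpς : 0 < p ^ (-ς) := Real.rpow_pos_of_pos hp _
  have hx : ‖x‖ < 1 := by
    rw [hx_def, norm_mul, norm_neg, Complex.norm_real, Real.norm_of_nonneg hpς.le,
      Real.rpow_neg hp.le, ← div_eq_mul_inv, div_lt_one (Real.rpow_pos_of_pos hp _)]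
    exact hωp
  obtain ⟨hsum, hsummable⟩ := risingFactorial_series hc hx
  set coef : ℕ → ℂ := fun k => risingFactorial δ k * (-ω) ^ k /
    (k.factorial * Complex.Gamma (ς * k + τ)) with hcoef
  have hp0 : (p : ℂ) ≠ 0 := Complex.ofReal_ne_zero.2 hp.ne'
  have hk : ∀ k : ℕ, 0 < (a + ς * k).re := fun k => by
    have : 0 ≤ ς * k := by positivity
    simp at ha ⊢
    linarith
  have hterm : ∀ t ∈ Ioi (0 : ℝ), ∀ k : ℕ,
      (t : ℂ) ^ (a - 1) * Complex.exp (-(p * t)) * prabTerm ς τ δ (-(ω * (t ^ ς : ℝ))) k =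
      coef k * ((t : ℂ) ^ (a + ς * k - 1) * Complex.exp (-(p * t))) := fun t ht k => by
    have ht0 : (t : ℂ) ≠ 0 := Complex.ofReal_ne_zero.2 (ne_of_gt ht)
    rw [hcoef, prabTerm, show -(ω * ((t ^ ς : ℝ) : ℂ)) = -ω * ((t ^ ς : ℝ) : ℂ) by ring, mul_pow,
      Complex.ofReal_cpow (le_of_lt ht),
      ← Complex.cpow_mul_nat, show a + ς * k - 1 = (a - 1) + ς * k by ring,
      Complex.cpow_add _ _ ht0]
    simp only [risingFactorial]
    ring
  have hpow : ∀ k : ℕ, (1 / p : ℂ) ^ (a + ς * k) = (p : ℂ) ^ (-a) * ((p ^ (-ς) : ℝ) : ℂ) ^ k := by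
    intro k
    rw [one_div, Complex.inv_cpow _ _ (by rw [Complex.arg_ofReal_of_nonneg hp.le]; exact
      Real.pi_ne_zero.symm), ← Complex.cpow_neg, neg_add, Complex.cpow_add _ _ hp0,
      Complex.ofReal_cpow hp.le, ← Complex.cpow_mul_nat]
    push_cast
    ring_nf
  have hint : ∀ k : ℕ, ∫ t in Ioi (0 : ℝ),
      coef k * ((t : ℂ) ^ (a + ς * k - 1) * Complex.exp (-(p * t))) =
      (p : ℂ) ^ (-a) * (risingFactorial δ k / k.factorial * x ^ k *
        risingFactorial (ς * k + τ) m) := fun k => by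
    rw [integral_const_mul, Complex.integral_cpow_mul_exp_neg_mul_Ioi (hk k) hp, hpow, hcoef]
    have h := inv_Gamma_eq_risingFactorial_mul (ς * k + τ) m
    rw [show (ς * k + τ + m : ℂ) = a + ς * k by rw [ha_def]; ring] at h
    have hΓ := Complex.Gamma_ne_zero_of_re_pos (hk k)
    dsimp only
    rw [div_eq_mul_inv, mul_inv, h, hx_def, mul_pow]
    field_simp
  have hnorm : ∀ k : ℕ, ∫ t in Ioi (0 : ℝ),
      ‖coef k * ((t : ℂ) ^ (a + ς * k - 1) * Complex.exp (-(p * t)))‖ =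
      ‖coef k‖ * (p ^ (-a.re) * (p ^ (-ς)) ^ k * Real.Gamma (a.re + ς * k)) := fun k => by
    have : ∀ t ∈ Ioi (0 : ℝ), ‖coef k * ((t : ℂ) ^ (a + ς * k - 1) * Complex.exp (-(p * t)))‖ =
        ‖coef k‖ * (t ^ (a.re + ς * k - 1) * Real.exp (-(p * t))) := fun t ht => by
      rw [norm_mul, norm_cpow_mul_exp_neg ht]
      simp
    rw [setIntegral_congr_fun measurableSet_Ioi this, integral_const_mul,
      Real.integral_rpow_mul_exp_neg_mul_Ioi (by simpa using hk k) hp, one_div,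
      Real.inv_rpow hp.le, ← Real.rpow_neg hp.le, neg_add, Real.rpow_add hp,
      ← Real.rpow_mul_natCast hp.le, neg_mul]
  have hintegrable : ∀ k : ℕ, IntegrableOn
      (fun t : ℝ => coef k * ((t : ℂ) ^ (a + ς * k - 1) * Complex.exp (-(p * t)))) (Ioi 0) := by
    intro k
    refine Integrable.const_mul ((integrable_norm_iff
      (measurable_cpow_mul_exp_neg _ _).aestronglyMeasurable).1 ?_) _
    have h := integrableOn_rpow_mul_exp_neg_mul_rpow (s := (a + ς * k).re - 1) (p := 1) (b := p)
      (by linarith [hk k]) one_pos hp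
    refine IntegrableOn.congr_fun h (fun t ht => ?_) measurableSet_Ioi
    rw [norm_cpow_mul_exp_neg ht]
    simp
  have hnormsum : Summable fun k : ℕ => ∫ t in Ioi (0 : ℝ),
      ‖coef k * ((t : ℂ) ^ (a + ς * k - 1) * Complex.exp (-(p * t)))‖ := by
    refine Summable.of_nonneg_of_le (fun k => integral_nonneg fun t => norm_nonneg _) (fun k => ?_)
      (hsummable.mul_left (p ^ (-a.re) * (Real.Gamma a.re / ‖Complex.Gamma a‖)))
    have h := Gamma_re_add_div_le hς ha k
    rw [hnorm, hcoef, hx_def]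
    simp only [norm_mul, norm_div, norm_pow, norm_neg, Complex.norm_real,
      Real.norm_of_nonneg hpς.le, mul_pow]
    calc _ = ‖risingFactorial δ k‖ * ‖ω‖ ^ k / ‖(k.factorial : ℂ)‖ *
          (p ^ (-a.re) * (p ^ (-ς)) ^ k) *
            (Real.Gamma (a.re + ς * k) / ‖Complex.Gamma (ς * k + τ)‖) := by ring
      _ ≤ ‖risingFactorial δ k‖ * ‖ω‖ ^ k / ‖(k.factorial : ℂ)‖ *
          (p ^ (-a.re) * (p ^ (-ς)) ^ k) *
            (Real.Gamma a.re / ‖Complex.Gamma a‖ * ‖risingFactorial (ς * k + τ) m‖) := by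
          gcongr
      _ = _ := by ring
  have h := hasSum_integral_of_summable_integral_norm hintegrable hnormsum
  simp_rw [hint] at h
  have h2 := h.unique (hsum.mul_left ((p : ℂ) ^ (-a)))
  rw [show (1 : ℂ) + ω * (p ^ (-ς) : ℝ) = 1 - x by rw [hx_def]; ring, ← h2]
  refine setIntegral_congr_fun measurableSet_Ioi fun t ht => ?_
  rw [cPrab, ← tsum_mul_left]
  exact tsum_congr fun k => hterm t ht k

lemma AnalyticAt.comp_complex_ofReal {f : ℂ → ℂ} {x : ℝ} (hf : AnalyticAt ℂ f x) :
    AnalyticAt ℝ (fun x : ℝ => f x) x :=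
  AnalyticAt.fun_comp (g := f) (f := fun x : ℝ => (x : ℂ)) hf.restrictScalars
    (Complex.ofRealCLM.analyticAt x)

lemma risingFactorial_ne_zero {z : ℂ} (hz : 0 < z.re) (k : ℕ) : risingFactorial z k ≠ 0 := by
  refine Finset.prod_ne_zero_iff.2 fun i _ h => ?_
  have := congrArg Complex.re h
  simp at this
  have : (0 : ℝ) ≤ i := Nat.cast_nonneg i
  linarith

/-- A function continuous on the positive reals cannot coincide with
`p ^ (-a) * ∑ d j * (1 - r p ^ (-ς)) ^ (-(δ + j))` to the right of its singularity. -/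
lemma not_eq_of_singularity {ς r : ℝ} (hς : 0 < ς) (hr : 0 < r) {δ a : ℂ} (hδ : 0 < δ.re) {m : ℕ}
    {d : ℕ → ℂ} (hd : d m ≠ 0) {L : ℝ → ℂ} (hL : ContinuousOn L (Ioi 0))
    (hLd : ∀ p : ℝ, 0 < p → r < p ^ ς → L p = (p : ℂ) ^ (-a) *
      ∑ j ∈ Finset.range (m + 1), d j * (1 + -r * (p ^ (-ς) : ℝ) : ℂ) ^ (-(δ + j))) : False := by
  set p₀ := r ^ ς⁻¹ with hp₀
  have hp₀pos : 0 < p₀ := Real.rpow_pos_of_pos hr _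
  have hp₀r : p₀ ^ ς = r := Real.rpow_inv_rpow hr.le hς.ne'
  set y : ℝ → ℝ := fun p => 1 - r * p ^ (-ς) with hy
  have hy₀ : y p₀ = 0 := by
    rw [hy]
    simp only
    rw [Real.rpow_neg hp₀pos.le, hp₀r, mul_inv_cancel₀ hr.ne', sub_self]
  have hycont : ContinuousAt y p₀ := by
    refine continuousAt_const.sub (continuousAt_const.mul ?_)
    exact Real.continuousAt_rpow_const _ _ (Or.inl hp₀pos.ne')
  have hylim : Tendsto y (𝓝[>] p₀) (𝓝 0) := by
    rw [← hy₀]; exact hycont.tendsto.mono_left nhdsWithin_le_nhds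
  have hbig : ∀ p ∈ Ioi p₀, r < p ^ ς := fun p hp => by
    rw [← hp₀r]; exact Real.rpow_lt_rpow hp₀pos.le hp hς
  have hypos : ∀ p ∈ Ioi p₀, 0 < y p := fun p hp => by
    have hp0 : 0 < p := hp₀pos.trans hp
    rw [hy]
    simp only
    rw [Real.rpow_neg hp0.le, ← div_eq_mul_inv, sub_pos, div_lt_one (Real.rpow_pos_of_pos hp0 _)]
    exact hbig p hp
  have hδm : 0 < (δ + m).re := by simp; positivity
  have h1 : Tendsto (fun p : ℝ => ((y p : ℝ) : ℂ) ^ (δ + m) * ((p : ℂ) ^ a * L p)) (𝓝[>] p₀)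
      (𝓝 (0 * ((p₀ : ℂ) ^ a * L p₀))) := by
    refine Tendsto.mul ?_ (Tendsto.mul ?_ ?_)
    · rw [tendsto_zero_iff_norm_tendsto_zero]
      have : Tendsto (fun p => y p ^ (δ + m).re) (𝓝[>] p₀) (𝓝 0) := by
        have := hylim.rpow_const (p := (δ + m).re) (Or.inr hδm.le)
        rwa [Real.zero_rpow hδm.ne'] at this
      refine this.congr' ?_
      filter_upwards [self_mem_nhdsWithin] with p hp
      rw [Complex.norm_cpow_eq_rpow_re_of_pos (hypos p hp)]
    · refine Tendsto.mono_left (ContinuousAt.tendsto ?_) nhdsWithin_le_nhds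
      exact Complex.continuousAt_ofReal_cpow_const _ _ (Or.inr hp₀pos.ne')
    · exact (hL.continuousAt (Ioi_mem_nhds hp₀pos)).tendsto.mono_left nhdsWithin_le_nhds
  have h2 : Tendsto (fun p : ℝ => ∑ j ∈ Finset.range (m + 1), d j * ((y p : ℝ) : ℂ) ^ (m - j))
      (𝓝[>] p₀) (𝓝 (∑ j ∈ Finset.range (m + 1), d j * ((0 : ℝ) : ℂ) ^ (m - j))) :=
    tendsto_finsetSum _ fun j _ => tendsto_const_nhds.mul
      (((Complex.continuous_ofReal.tendsto 0).comp hylim).pow _)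
  have h3 : ∑ j ∈ Finset.range (m + 1), d j * ((0 : ℝ) : ℂ) ^ (m - j) = d m := by
    rw [Finset.sum_eq_single m]
    · simp
    · intro j hj hjm
      rw [Finset.mem_range] at hj
      have : m - j ≠ 0 := by omega
      simp [this]
    · simp
  rw [h3] at h2
  refine hd ?_
  rw [← zero_mul ((p₀ : ℂ) ^ a * L p₀)]
  refine tendsto_nhds_unique (h2.congr' ?_) h1
  filter_upwards [self_mem_nhdsWithin] with p hp
  have hp0 : 0 < p := hp₀pos.trans hp
  have hpc : (p : ℂ) ≠ 0 := Complex.ofReal_ne_zero.2 hp0.ne'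
  have hyc : ((y p : ℝ) : ℂ) ≠ 0 := Complex.ofReal_ne_zero.2 (hypos p hp).ne'
  have hy1 : (1 + -r * (p ^ (-ς) : ℝ) : ℂ) = ((y p : ℝ) : ℂ) := by
    rw [hy]; push_cast; ring
  rw [hLd p hp0 (hbig p hp), hy1, ← mul_assoc ((p : ℂ) ^ a), ← Complex.cpow_add _ _ hpc,
    add_neg_cancel, Complex.cpow_zero, one_mul, Finset.mul_sum]
  refine Finset.sum_congr rfl fun j hj => ?_
  have hj : j ≤ m := Nat.lt_succ_iff.1 (Finset.mem_range.1 hj)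
  rw [mul_left_comm, ← Complex.cpow_add _ _ hyc, ← Complex.cpow_natCast, Nat.cast_sub hj]
  ring_nf

lemma eqOn_of_eq_of_large {ς : ℝ} (hς : 0 < ς) {ω δ a : ℂ} (hω : ω ∈ Complex.slitPlane) {n : ℕ}
    {d : ℕ → ℂ} {L : ℂ → ℂ} (hL : DifferentiableOn ℂ L {z | 0 < z.re})
    (hLd : ∀ p : ℝ, 0 < p → ‖ω‖ < p ^ ς → L p = (p : ℂ) ^ (-a) *
      ∑ j ∈ Finset.range n, d j * (1 + ω * (p ^ (-ς) : ℝ)) ^ (-(δ + j))) {p : ℝ} (hp : 0 < p) :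
    L p = (p : ℂ) ^ (-a) *
      ∑ j ∈ Finset.range n, d j * (1 + ω * (p ^ (-ς) : ℝ)) ^ (-(δ + j)) := by
  have hf : AnalyticOnNhd ℝ (fun p : ℝ => L p) (Ioi 0) := fun p hp =>
    (hL.analyticOnNhd (isOpen_lt continuous_const Complex.continuous_re) p
      (by simpa using hp)).comp_complex_ofReal
  have hg : AnalyticOnNhd ℝ (fun p : ℝ => (p : ℂ) ^ (-a) *
      ∑ j ∈ Finset.range n, d j * (1 + ω * (p : ℂ) ^ (-ς : ℂ)) ^ (-(δ + j))) (Ioi 0) := by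
    intro p hp
    have hp0 : (0 : ℝ) < p := hp
    refine AnalyticAt.comp_complex_ofReal (f := fun z : ℂ => z ^ (-a) *
      ∑ j ∈ Finset.range n, d j * (1 + ω * z ^ (-ς : ℂ)) ^ (-(δ + j))) ?_
    have hpow : ∀ b : ℂ, AnalyticAt ℂ (fun z : ℂ => z ^ b) p := fun b =>
      analyticAt_id.cpow analyticAt_const (by simp [hp0])
    refine (hpow _).mul (Finset.analyticAt_fun_sum _ fun j _ => analyticAt_const.mul ?_)
    refine (analyticAt_const.add (analyticAt_const.mul (hpow _))).cpow analyticAt_const ?_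
    change 1 + ω * (p : ℂ) ^ (-ς : ℂ) ∈ Complex.slitPlane
    rw [← Complex.ofReal_neg, ← Complex.ofReal_cpow hp0.le]
    exact one_add_mul_mem_slitPlane hω (Real.rpow_nonneg hp0.le _)
  have hcast : ∀ p ∈ Ioi (0 : ℝ), ((p ^ (-ς) : ℝ) : ℂ) = (p : ℂ) ^ (-ς : ℂ) := fun p hp => by
    rw [Complex.ofReal_cpow (le_of_lt hp), Complex.ofReal_neg]
  set p₁ := (‖ω‖ + 1) ^ ς⁻¹ with hp₁
  have hp₁pos : 0 < p₁ := by positivity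
  have hlarge : ‖ω‖ < p₁ ^ ς := by
    rw [hp₁, Real.rpow_inv_rpow (by positivity) hς.ne']; linarith
  have hev : (fun p : ℝ => L p) =ᶠ[𝓝 p₁] (fun p : ℝ => (p : ℂ) ^ (-a) *
      ∑ j ∈ Finset.range n, d j * (1 + ω * (p : ℂ) ^ (-ς : ℂ)) ^ (-(δ + j))) := by
    have hc := (Real.continuousAt_rpow_const p₁ ς (Or.inl hp₁pos.ne')).eventually_const_lt hlarge
    filter_upwards [Ioi_mem_nhds hp₁pos, hc] with p hp hp'
    rw [hLd p hp hp', hcast p hp]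
  rw [hcast p hp]
  exact hf.eqOn_of_preconnected_of_eventuallyEq hg isPreconnected_Ioi hp₁pos hev hp

lemma mellin_sum_one_add_mul_cpow {ς τ δ s ω : ℂ} (hs : 0 < s.re) (hsδ : s.re < δ.re)
    (hω : ω ∈ Complex.slitPlane) {m : ℕ} {c : ℕ → ℂ}
    (hc : ∀ x, risingFactorial (ς * x + τ) m =
      ∑ j ∈ Finset.range (m + 1), c j * risingFactorial (δ + x) j) :
    mellin (fun q : ℝ => ∑ j ∈ Finset.range (m + 1),
      c j * risingFactorial δ j * (1 + ω * q) ^ (-(δ + j))) s =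
    ω ^ (-s) * (Complex.Gamma s * Complex.Gamma (δ - s) / Complex.Gamma δ) *
      risingFactorial (τ - ς * s) m := by
  have hδ : 0 < δ.re := hs.trans hsδ
  have hsj : ∀ j : ℕ, s.re < (δ + j).re := fun j => by
    have : (0 : ℝ) ≤ j := Nat.cast_nonneg j
    simp; linarith
  have h1 : mellin (fun q : ℝ => ∑ j ∈ Finset.range (m + 1),
      c j * risingFactorial δ j * (1 + ω * q) ^ (-(δ + j))) s =
      ∑ j ∈ Finset.range (m + 1), c j * risingFactorial δ j *
        mellin (fun q : ℝ => (1 + ω * q) ^ (-(δ + j))) s := by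
    simp_rw [mellin, smul_eq_mul, Finset.mul_sum]
    rw [integral_finsetSum]
    · refine Finset.sum_congr rfl fun j _ => ?_
      rw [← integral_const_mul]
      congr 1 with q
      ring
    · intro j _
      have :=
        (mellinConvergent_and_differentiableAt_one_add_mul_cpow hs (hsj j) hω).1.const_smul
          (c j * risingFactorial δ j)
      simpa [MellinConvergent, IntegrableOn, smul_eq_mul] using this
  rw [h1, show τ - ς * s = ς * (-s) + τ by ring, hc, Finset.mul_sum]
  refine Finset.sum_congr rfl fun j _ => ?_
  rw [mellin_one_add_mul_cpow hs (hsj j) hω]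
  have e1 := inv_Gamma_eq_risingFactorial_mul δ j
  have e2 := inv_Gamma_eq_risingFactorial_mul (δ - s) j
  have hδs : 0 < (δ - s).re := by simpa using hsδ
  have n1 := Complex.Gamma_ne_zero_of_re_pos hδ
  have n2 := Complex.Gamma_ne_zero_of_re_pos hδs
  have n3 := Complex.Gamma_ne_zero_of_re_pos (hs.trans (hsj j))
  have n4 : Complex.Gamma (δ - s + j) ≠ 0 := Complex.Gamma_ne_zero_of_re_pos (by
    have := hsj j
    simp at this ⊢
    linarith)
  rw [show δ + -s = δ - s by ring, show δ + j - s = δ - s + j by ring]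
  field_simp at e1 e2 ⊢
  rw [e2, e1]
  ring

theorem prabhakar_mellin_transform (ς : ℝ) (ω τ δ s : ℂ) (hς : 0 < ς)
    (hω : ω ≠ 0) (hs : 0 < s.re) (hsδ : s.re < δ.re) (hδ : 0 < δ.re)
    (hint : MeasureTheory.IntegrableOn
      (fun t : ℝ => (t : ℂ) ^ (s - 1) * cPrab (ς : ℂ) τ δ (-(ω * (t : ℂ))))
      (Set.Ioi 0)) :
    ∫ t in Set.Ioi (0 : ℝ), (t : ℂ) ^ (s - 1) * cPrab (ς : ℂ) τ δ (-(ω * (t : ℂ))) =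
      Complex.Gamma s * Complex.Gamma (δ - s) * ω ^ (-s) /
        (Complex.Gamma δ * Complex.Gamma (τ - (ς : ℂ) * s)) := by
  set G : ℝ → ℂ := fun t => cPrab ς τ δ (-(ω * t)) with hG
  have hςc : (ς : ℂ) ≠ 0 := Complex.ofReal_ne_zero.2 hς.ne'
  obtain ⟨m, hm⟩ := exists_nat_gt (max (-τ.re) (ς * s.re - τ.re))
  obtain ⟨hm1, hm2⟩ := max_lt_iff.1 hm
  have ha : 0 < (τ + m).re := by simp; linarith
  set b : ℂ := τ + m - ς * s with hb_def
  have hb : 0 < b.re := by simp [hb_def]; linarith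
  obtain ⟨c, hc, hcm⟩ := exists_risingFactorial_expansion (ς : ℂ) τ δ m
  have hGconv : MellinConvergent (fun t => G (t ^ ς)) (ς * s) := by
    rw [MellinConvergent.comp_rpow hς.ne', mul_div_cancel_left₀ _ hςc]
    exact hint
  have hGm : mellin (fun t => G (t ^ ς)) (ς * s) = ς⁻¹ • mellin G s := by
    rw [mellin_comp_rpow, mul_div_cancel_left₀ _ hςc, abs_of_pos hς]
  set F : ℝ → ℂ := fun t => (t : ℂ) ^ ((ς : ℂ) * s - 1) • G (t ^ ς) with hF
  have hFint : IntegrableOn F (Ioi 0) := hGconv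
  set L : ℂ → ℂ := fun p => ∫ t in Ioi (0 : ℝ), F t * ((t : ℂ) ^ b * Complex.exp (-(p * t)))
    with hL
  have hLdiff : DifferentiableOn ℂ L {z | 0 < z.re} := fun p hp =>
    (differentiableAt_laplace hFint hb hp).differentiableWithinAt
  have hLlarge : ∀ p : ℝ, 0 < p → ‖ω‖ < p ^ ς → L p = (p : ℂ) ^ (-(τ + m)) *
      ∑ j ∈ Finset.range (m + 1), c j * risingFactorial δ j *
        (1 + ω * (p ^ (-ς) : ℝ)) ^ (-(δ + j)) := fun p hp hωp => by
    rw [← laplace_cPrab hς ω δ ha hc hp hωp]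
    refine setIntegral_congr_fun measurableSet_Ioi fun t ht => ?_
    have ht0 : (t : ℂ) ≠ 0 := Complex.ofReal_ne_zero.2 (ne_of_gt ht)
    rw [hF, hG, show τ + m - 1 = (ς * s - 1) + b by rw [hb_def]; ring, Complex.cpow_add _ _ ht0]
    simp only [smul_eq_mul]
    ring
  have hslit : ω ∈ Complex.slitPlane := by
    by_contra hns
    rw [Complex.mem_slitPlane_iff, not_or, not_lt, not_not] at hns
    have hre : ω.re ≠ 0 := fun h => hω (Complex.ext h hns.2)
    have hr : 0 < -ω.re := by
      have := lt_of_le_of_ne hns.1 hre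
      linarith
    have hωr : ω = -((-ω.re : ℝ) : ℂ) := by
      apply Complex.ext <;> simp [hns.2]
    refine not_eq_of_singularity (a := τ + m) (m := m) (d := fun j => c j * risingFactorial δ j)
      (L := fun p => L p) hς hr hδ ?_ ?_ ?_
    · rw [hcm]
      exact mul_ne_zero (pow_ne_zero _ hςc) (risingFactorial_ne_zero hδ m)
    · exact hLdiff.continuousOn.comp Complex.continuous_ofReal.continuousOn
        fun p hp => by simpa using hp
    · intro p hp hrp
      rw [← hωr]
      refine hLlarge p hp ?_
      rwa [hωr, norm_neg, Complex.norm_real, Real.norm_of_nonneg hr.le]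
  have hLeq : ∀ p : ℝ, 0 < p → L p = (p : ℂ) ^ (-(τ + m)) *
      ∑ j ∈ Finset.range (m + 1), c j * risingFactorial δ j *
        (1 + ω * (p ^ (-ς) : ℝ)) ^ (-(δ + j)) := fun p hp =>
    eqOn_of_eq_of_large hς hslit hLdiff hLlarge hp
  have hmL : mellin (fun p : ℝ => L p) b = Complex.Gamma b * (ς⁻¹ • mellin G s) := by
    rw [← hGm]
    exact (mellin_laplace hFint hb).2
  have hmΦ : mellin (fun p : ℝ => L p) b = ς⁻¹ •
      (ω ^ (-s) * (Complex.Gamma s * Complex.Gamma (δ - s) / Complex.Gamma δ) *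
        risingFactorial (τ - ς * s) m) := by
    have h := mellin_comp_rpow (fun q : ℝ => ∑ j ∈ Finset.range (m + 1),
      c j * risingFactorial δ j * (1 + ω * q) ^ (-(δ + j))) (-(ς * s)) (-ς)
    rw [Complex.ofReal_neg, neg_div_neg_eq, mul_div_cancel_left₀ _ hςc, abs_neg, abs_of_pos hς,
      mellin_sum_one_add_mul_cpow hs hsδ hslit hc] at h
    rw [← h]
    refine setIntegral_congr_fun measurableSet_Ioi fun p hp => ?_
    have hp0 : (p : ℂ) ≠ 0 := Complex.ofReal_ne_zero.2 (ne_of_gt hp)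
    simp only [smul_eq_mul]
    rw [hLeq p hp, ← mul_assoc, ← Complex.cpow_add _ _ hp0, hb_def]
    ring_nf
  have hΓb := Complex.Gamma_ne_zero_of_re_pos hb
  have hfinal := hmL.symm.trans hmΦ
  rw [mul_smul_comm] at hfinal
  have hfinal' := smul_right_injective ℂ (inv_ne_zero hς.ne') hfinal
  have e := inv_Gamma_eq_risingFactorial_mul (τ - ς * s) m
  rw [show τ - ς * s + m = b by rw [hb_def]; ring] at e
  change mellin G s = _
  rw [div_eq_mul_inv, mul_inv, e]
  field_simp at hfinal' ⊢
  linear_combination hfinal'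
end
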